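/- arXiv:2410.10598 — 3 statements merged into one kernel-verified Lean document; each statement's English description precedes it below -/
import Mathlib

section
/- For all n ≥ 4, the polynomial A_n − ( z^n − n·z^{n−2}·w + ((n² − 3n)/2)·z^{n−4}·w² ) in ℤ[z,w] has total degree at most n − 3. In other words, A_n(z) = z^n − n z^{n−2} z̄ + ((n²−3n)/2) z^{n−4} z̄² + O(n−3), where O(d) denotes a polynomial of total degree at most d. -/
open MvPolynomial

/-- The folding polynomials `A_n ∈ ℤ[z,w]` of the Lie algebra `𝒜₂`, where the
variable `X 0 = z` and `X 1 = w` plays the role of the complex conjugate `z̄`: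
`A_0 = 3`, `A_1 = z`, `A_2 = z² − 2w`, and
`A_n = z·A_{n−1} − w·A_{n−2} + A_{n−3}` for `n ≥ 3`. -/
noncomputable def Afold : ℕ → MvPolynomial (Fin 2) ℤ
  | 0 => 3
  | 1 => X 0
  | 2 => X 0 ^ 2 - 2 * X 1
  | n + 3 => X 0 * Afold (n + 2) - X 1 * Afold (n + 1) + Afold n

theorem totalDegree_X_mul_le {σ R : Type*} [CommSemiring R] [Nontrivial R] (i : σ)
    {p : MvPolynomial σ R} {d : ℕ} (hp : p.totalDegree ≤ d) :
    (X i * p).totalDegree ≤ d + 1 := by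
  have h := totalDegree_mul (X i) p
  rw [totalDegree_X] at h
  lia

theorem Afold_totalDegree_le (n : ℕ) : (Afold n).totalDegree ≤ n := by
  induction n using Afold.induct with
  | case1 => exact (totalDegree_C (3 : ℤ)).le
  | case2 => simp [Afold]
  | case3 =>
    refine (totalDegree_sub _ _).trans (max_le (totalDegree_X_pow _ _).le ?_)
    rw [mul_comm]
    exact (totalDegree_X_mul_le 1 (totalDegree_C (2 : ℤ)).le).trans one_le_two
  | case4 n h₂ h₁ h₀ =>
    rw [Afold]
    refine (totalDegree_add _ _).trans (max_le ((totalDegree_sub _ _).trans (max_le ?_ ?_)) ?_)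
    · exact totalDegree_X_mul_le 0 h₂
    · exact (totalDegree_X_mul_le 1 h₁).trans (by lia)
    · lia

/-- The leading terms of `Afold (n + 4)`. -/
noncomputable def AfoldLead (n : ℕ) : MvPolynomial (Fin 2) ℤ :=
  X 0 ^ (n + 4) - C ((n : ℤ) + 4) * X 0 ^ (n + 2) * X 1
    + C ((((n : ℤ) + 4) ^ 2 - 3 * ((n : ℤ) + 4)) / 2) * X 0 ^ n * X 1 ^ 2

theorem AfoldLead_add_two (n : ℕ) :
    AfoldLead (n + 2) = X 0 * AfoldLead (n + 1) - X 1 * AfoldLead n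
      + X 1 * (X 1 * (X 1 * (C ((((n : ℤ) + 4) ^ 2 - 3 * ((n : ℤ) + 4)) / 2) * X 0 ^ n))) := by
  have hc : ((((n + 2 : ℕ) : ℤ) + 4) ^ 2 - 3 * (((n + 2 : ℕ) : ℤ) + 4)) / 2
      = ((((n + 1 : ℕ) : ℤ) + 4) ^ 2 - 3 * (((n + 1 : ℕ) : ℤ) + 4)) / 2 + (n + 4) := by
    rw [← Int.add_mul_ediv_right _ _ two_ne_zero]
    congr 1
    push_cast
    ring
  simp only [AfoldLead, hc]
  push_cast
  simp only [map_add, map_natCast, map_ofNat, map_one]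
  ring

theorem totalDegree_Afold_sub_AfoldLead_le (n : ℕ) :
    (Afold (n + 4) - AfoldLead n).totalDegree ≤ n + 1 := by
  induction n using Nat.twoStepInduction with
  | zero =>
    have h : Afold 4 - AfoldLead 0 = X 0 * C 4 := by
      norm_num [Afold, AfoldLead]
      ring
    rw [zero_add, h]
    exact totalDegree_X_mul_le 0 (totalDegree_C (4 : ℤ)).le
  | one =>
    have h : Afold 5 - AfoldLead 1 = X 0 * (X 0 * C 5) - X 1 * C 5 := by
      norm_num [Afold, AfoldLead]
      ring
    rw [h]
    have h₅ : (C 5 : MvPolynomial (Fin 2) ℤ).totalDegree ≤ 0 := (totalDegree_C 5).le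
    exact (totalDegree_sub _ _).trans (max_le
      (totalDegree_X_mul_le 0 (totalDegree_X_mul_le 0 h₅))
      ((totalDegree_X_mul_le 1 h₅).trans one_le_two))
  | more n h₀ h₁ =>
    have h : Afold (n + 2 + 4) - AfoldLead (n + 2)
        = X 0 * (Afold (n + 1 + 4) - AfoldLead (n + 1)) - X 1 * (Afold (n + 4) - AfoldLead n)
          - X 1 * (X 1 * (X 1 * (C ((((n : ℤ) + 4) ^ 2 - 3 * ((n : ℤ) + 4)) / 2) * X 0 ^ n)))
          + Afold (n + 3) := by
      rw [AfoldLead_add_two, show n + 2 + 4 = n + 3 + 3 by rfl, Afold]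
      ring
    have hp (c : ℤ) : (C c * X 0 ^ n : MvPolynomial (Fin 2) ℤ).totalDegree ≤ n := by
      have h := totalDegree_mul (C c) (X 0 ^ n : MvPolynomial (Fin 2) ℤ)
      rwa [totalDegree_C, totalDegree_X_pow, zero_add] at h
    rw [h]
    refine (totalDegree_add _ _).trans (max_le ((totalDegree_sub _ _).trans (max_le
      ((totalDegree_sub _ _).trans (max_le ?_ ?_)) ?_)) (Afold_totalDegree_le _))
    · exact totalDegree_X_mul_le 0 h₁
    · exact (totalDegree_X_mul_le 1 h₀).trans (by lia)
    · exact totalDegree_X_mul_le 1 (totalDegree_X_mul_le 1 (totalDegree_X_mul_le 1 (hp _)))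

/-- For `n ≥ 4`, `A_n(z) = z^n − n z^{n−2} w + ((n²−3n)/2) z^{n−4} w² + O(n−3)`,
where `O(d)` denotes a polynomial of total degree at most `d`. -/
theorem Afold_leading_terms (n : ℕ) (hn : 4 ≤ n) :
    (Afold n - (X 0 ^ n - C (n : ℤ) * X 0 ^ (n - 2) * X 1
        + C (((n : ℤ) ^ 2 - 3 * (n : ℤ)) / 2) * X 0 ^ (n - 4) * X 1 ^ 2)).totalDegree
      ≤ n - 3 := by
  obtain ⟨k, rfl⟩ := Nat.exists_eq_add_of_le' hn
  have h := totalDegree_Afold_sub_AfoldLead_le k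
  rw [AfoldLead] at h
  simpa using h
end

section
/- For all n ≥ 4, the polynomial X_n − ( x^n − n·x^{n−2}·y − n·x^{n−2} + (n(n−3)/2)·x^{n−4}·y² ) in ℤ[x,y] has total degree at most n − 3. -/
open MvPolynomial

/-- The first coordinates `X_n ∈ ℤ[x,y]` of the folding maps `B_n = 𝖥_n[𝓑₂]`
(with `X 0 = x`, `X 1 = y`): `X_0 = 4`, `X_1 = x`, `X_2 = x²−2y−4`,
`X_3 = x³−3xy−3x`, and `X_{n+4} = x(X_{n+3}+X_{n+1}) − (2+y)X_{n+2} − X_n`. -/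
noncomputable def XB : ℕ → MvPolynomial (Fin 2) ℤ
  | 0 => 4
  | 1 => X 0
  | 2 => X 0 ^ 2 - 2 * X 1 - 4
  | 3 => X 0 ^ 3 - 3 * X 0 * X 1 - 3 * X 0
  | n + 4 => X 0 * (XB (n + 3) + XB (n + 1)) - (2 + X 1) * XB (n + 2) - XB n

/-- The second coordinates `Y_n ∈ ℤ[x,y]` of the folding maps `B_n = 𝖥_n[𝓑₂]`
(with `X 0 = x`, `X 1 = y`): `Y_0 = 4`, `Y_1 = y`, `Y_2 = y²−2x²+4y+4`,
`Y_3 = y³−3x²y+6y²+9y`, and `Y_{n+4} = y(Y_{n+3}+Y_{n+1}) − (x²−2y−2)Y_{n+2} − Y_n`. -/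
noncomputable def YB : ℕ → MvPolynomial (Fin 2) ℤ
  | 0 => 4
  | 1 => X 1
  | 2 => X 1 ^ 2 - 2 * X 0 ^ 2 + 4 * X 1 + 4
  | 3 => X 1 ^ 3 - 3 * X 0 ^ 2 * X 1 + 6 * X 1 ^ 2 + 9 * X 1
  | n + 4 => X 1 * (YB (n + 3) + YB (n + 1)) - (X 0 ^ 2 - 2 * X 1 - 2) * YB (n + 2) - YB n

section DegreeBounds

variable {σ R : Type*} [CommRing R] {p q : MvPolynomial σ R} {a b k : ℕ}

theorem totalDegree_add_le_of_le (hp : p.totalDegree ≤ k) (hq : q.totalDegree ≤ k) :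
    (p + q).totalDegree ≤ k :=
  (totalDegree_add p q).trans (max_le hp hq)

theorem totalDegree_sub_le_of_le (hp : p.totalDegree ≤ k) (hq : q.totalDegree ≤ k) :
    (p - q).totalDegree ≤ k :=
  (totalDegree_sub p q).trans (max_le hp hq)

theorem totalDegree_mul_le_of_le (hp : p.totalDegree ≤ a) (hq : q.totalDegree ≤ b)
    (h : a + b ≤ k) : (p * q).totalDegree ≤ k :=
  (totalDegree_mul p q).trans ((add_le_add hp hq).trans h)

theorem totalDegree_C_mul_le_of_le (r : R) (hp : p.totalDegree ≤ k) :
    (C r * p).totalDegree ≤ k :=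
  totalDegree_mul_le_of_le (totalDegree_C r).le hp (zero_add k).le

theorem totalDegree_C_le (r : R) (k : ℕ) : (C r : MvPolynomial σ R).totalDegree ≤ k :=
  (totalDegree_C r).trans_le k.zero_le

theorem totalDegree_X_le (i : σ) (h : 1 ≤ k) : (X i : MvPolynomial σ R).totalDegree ≤ k :=
  ((totalDegree_monomial_le _ _).trans (by simp)).trans h

theorem totalDegree_X_mul_le_of_le (i : σ) (hp : p.totalDegree ≤ k) :
    (X i * p).totalDegree ≤ k + 1 :=
  totalDegree_mul_le_of_le (totalDegree_X_le i le_rfl) hp (add_comm 1 k).le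

theorem totalDegree_X_pow_le (i : σ) (m : ℕ) : (X i ^ m : MvPolynomial σ R).totalDegree ≤ m :=
  (totalDegree_pow _ m).trans
    ((Nat.mul_le_mul_left m (totalDegree_X_le i le_rfl)).trans (mul_one m).le)

theorem totalDegree_X_pow_mul_X_le (i j : σ) (m : ℕ) :
    (X i ^ m * X j : MvPolynomial σ R).totalDegree ≤ m + 1 :=
  totalDegree_mul_le_of_le (totalDegree_X_pow_le i m) (totalDegree_X_le j le_rfl) le_rfl

end DegreeBounds

theorem XB_add_four (n : ℕ) :
    XB (n + 4) = X 0 * (XB (n + 3) + XB (n + 1)) - (C 2 + X 1) * XB (n + 2) - XB n := by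
  rw [XB]
  rfl

/-- `X_n` has total degree at most `n`. -/
theorem totalDegree_XB_le : ∀ n : ℕ, (XB n).totalDegree ≤ n
  | 0 => by
    rw [XB]
    exact totalDegree_C_le 4 0
  | 1 => by
    rw [XB]
    exact totalDegree_X_le 0 le_rfl
  | 2 => by
    rw [XB]
    exact totalDegree_sub_le_of_le (totalDegree_sub_le_of_le (totalDegree_X_pow_le 0 2)
      (totalDegree_C_mul_le_of_le 2 (totalDegree_X_le 1 one_le_two))) (totalDegree_C_le 4 2)
  | 3 => by
    rw [XB]
    have h (k : ℕ) (hk : 1 ≤ k) : (C 3 * X 0 : MvPolynomial (Fin 2) ℤ).totalDegree ≤ k :=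
      totalDegree_C_mul_le_of_le 3 (totalDegree_X_le 0 hk)
    exact totalDegree_sub_le_of_le (totalDegree_sub_le_of_le (totalDegree_X_pow_le 0 3)
      (totalDegree_mul_le_of_le (h 1 le_rfl) (totalDegree_X_le 1 le_rfl) (by norm_num)))
      (h 3 (by norm_num))
  | n + 4 => by
    have h0 := totalDegree_XB_le n
    have h1 := totalDegree_XB_le (n + 1)
    have h2 := totalDegree_XB_le (n + 2)
    have h3 := totalDegree_XB_le (n + 3)
    rw [XB_add_four]
    exact totalDegree_sub_le_of_le (totalDegree_sub_le_of_le
      (totalDegree_X_mul_le_of_le 0 (totalDegree_add_le_of_le h3 (h1.trans (by lia))))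
      (totalDegree_mul_le_of_le (totalDegree_add_le_of_le (totalDegree_C_le 2 1)
        (totalDegree_X_le 1 le_rfl)) h2 (by lia))) (h0.trans (by lia))

/-- The terms `x^{n+2} - (n+2) x^n y` give `X_{n+2}` up to total degree `n`. -/
theorem totalDegree_XB_sub_two_terms_le : ∀ n : ℕ,
    (XB (n + 2) - (X 0 ^ (n + 2) - C ((n : ℤ) + 2) * (X 0 ^ n * X 1))).totalDegree ≤ n
  | 0 => by
    have h : XB (0 + 2) - (X 0 ^ (0 + 2) - C (((0 : ℕ) : ℤ) + 2) * (X 0 ^ 0 * X 1)) = C (-4) := by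
      rw [XB]
      simp only [map_add, map_neg, map_ofNat, Nat.cast_zero, map_zero]
      ring
    rw [h]
    exact totalDegree_C_le _ 0
  | 1 => by
    have h : XB (1 + 2) - (X 0 ^ (1 + 2) - C (((1 : ℕ) : ℤ) + 2) * (X 0 ^ 1 * X 1))
        = C (-3) * X 0 := by
      rw [XB]
      simp only [map_add, map_neg, map_ofNat, Nat.cast_one, map_one]
      ring
    rw [h]
    exact totalDegree_C_mul_le_of_le _ (totalDegree_X_le 0 le_rfl)
  | n + 2 => by
    have h0 := totalDegree_XB_le n
    have h1 := totalDegree_XB_le (n + 1)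
    have h2 := totalDegree_XB_le (n + 2)
    have h3 := totalDegree_XB_sub_two_terms_le (n + 1)
    have e2 := totalDegree_XB_sub_two_terms_le n
    have key : XB (n + 2 + 2) - (X 0 ^ (n + 2 + 2)
          - C (((n + 2 : ℕ) : ℤ) + 2) * (X 0 ^ (n + 2) * X 1))
        = X 0 * (XB (n + 1 + 2) - (X 0 ^ (n + 1 + 2)
            - C (((n + 1 : ℕ) : ℤ) + 2) * (X 0 ^ (n + 1) * X 1)))
          + X 0 * XB (n + 1) - C 2 * XB (n + 2)
          - X 1 * (XB (n + 2) - (X 0 ^ (n + 2) - C ((n : ℤ) + 2) * (X 0 ^ n * X 1)))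
          + C ((n : ℤ) + 2) * (X 0 ^ n * X 1 ^ 2) - XB n := by
      rw [XB_add_four]
      push_cast
      simp only [map_add, map_ofNat, map_one]
      ring
    rw [key]
    refine totalDegree_sub_le_of_le (totalDegree_add_le_of_le (totalDegree_sub_le_of_le
      (totalDegree_sub_le_of_le (totalDegree_add_le_of_le
        (totalDegree_X_mul_le_of_le 0 h3) (totalDegree_X_mul_le_of_le 0 h1))
        (totalDegree_C_mul_le_of_le 2 h2))
        ((totalDegree_X_mul_le_of_le 1 e2).trans (by lia)))
      (totalDegree_C_mul_le_of_le _ (totalDegree_mul_le_of_le (totalDegree_X_pow_le 0 n)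
        (totalDegree_X_pow_le 1 2) le_rfl))) (h0.trans (by lia))

/-- The four leading terms of `X_{n+4}` give it up to total degree `n + 1`. -/
theorem totalDegree_XB_sub_four_terms_le (n : ℕ) :
    (XB (n + 4) - (X 0 ^ (n + 4) - C ((n : ℤ) + 4) * X 0 ^ (n + 2) * X 1
        - C ((n : ℤ) + 4) * X 0 ^ (n + 2)
        + C (((n : ℤ) + 4) * ((n : ℤ) + 1) / 2) * X 0 ^ n * X 1 ^ 2)).totalDegree ≤ n + 1 := by
  induction n with
  | zero =>
    have h : XB (0 + 4) - (X 0 ^ (0 + 4) - C (((0 : ℕ) : ℤ) + 4) * X 0 ^ (0 + 2) * X 1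
        - C (((0 : ℕ) : ℤ) + 4) * X 0 ^ (0 + 2)
        + C ((((0 : ℕ) : ℤ) + 4) * (((0 : ℕ) : ℤ) + 1) / 2) * X 0 ^ 0 * X 1 ^ 2)
        = C 8 * X 1 + C 4 := by
      have hc : ((((0 : ℕ) : ℤ) + 4) * (((0 : ℕ) : ℤ) + 1) / 2) = 2 := by norm_num
      rw [hc, XB_add_four, XB, XB, XB, XB]
      simp only [map_add, map_ofNat, Nat.cast_zero, map_zero]
      ring
    rw [h]
    exact totalDegree_add_le_of_le (totalDegree_C_mul_le_of_le 8 (totalDegree_X_le 1 le_rfl))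
      (totalDegree_C_le 4 1)
  | succ n ih =>
    have h1 := totalDegree_XB_le (n + 1)
    have e2 := totalDegree_XB_sub_two_terms_le n
    have e3 := totalDegree_XB_sub_two_terms_le (n + 1)
    have hc : (((n + 1 : ℕ) : ℤ) + 4) * (((n + 1 : ℕ) : ℤ) + 1) / 2
        = ((n : ℤ) + 4) * ((n : ℤ) + 1) / 2 + ((n : ℤ) + 3) := by
      rw [← Int.add_mul_ediv_right _ _ two_ne_zero]
      congr 1
      push_cast
      ring
    rw [hc]
    generalize ((n : ℤ) + 4) * ((n : ℤ) + 1) / 2 = c at ih ⊢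
    have key : XB (n + 1 + 4) - (X 0 ^ (n + 1 + 4)
          - C (((n + 1 : ℕ) : ℤ) + 4) * X 0 ^ (n + 1 + 2) * X 1
          - C (((n + 1 : ℕ) : ℤ) + 4) * X 0 ^ (n + 1 + 2)
          + C (c + ((n : ℤ) + 3)) * X 0 ^ (n + 1) * X 1 ^ 2)
        = X 0 * (XB (n + 4) - (X 0 ^ (n + 4) - C ((n : ℤ) + 4) * X 0 ^ (n + 2) * X 1
            - C ((n : ℤ) + 4) * X 0 ^ (n + 2) + C c * X 0 ^ n * X 1 ^ 2))
          + X 0 * (XB (n + 2) - (X 0 ^ (n + 2) - C ((n : ℤ) + 2) * (X 0 ^ n * X 1)))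
          - (C 2 + X 1) * (XB (n + 1 + 2) - (X 0 ^ (n + 1 + 2)
            - C (((n + 1 : ℕ) : ℤ) + 2) * (X 0 ^ (n + 1) * X 1)))
          + C ((n : ℤ) + 4) * (X 0 ^ (n + 1) * X 1) - XB (n + 1) := by
      rw [XB_add_four]
      push_cast
      simp only [map_add, map_ofNat, map_one]
      ring
    rw [key]
    refine totalDegree_sub_le_of_le (totalDegree_add_le_of_le (totalDegree_sub_le_of_le
      (totalDegree_add_le_of_le (totalDegree_X_mul_le_of_le 0 ih)
        ((totalDegree_X_mul_le_of_le 0 e2).trans (by lia)))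
      (totalDegree_mul_le_of_le (totalDegree_add_le_of_le (totalDegree_C_le 2 1)
        (totalDegree_X_le 1 le_rfl)) e3 (by lia)))
      (totalDegree_C_mul_le_of_le _ (totalDegree_X_pow_mul_X_le 0 1 (n + 1))))
      (h1.trans (by lia))

/-- For `n ≥ 4`, the polynomial
`X_n − (x^n − n x^{n−2} y − n x^{n−2} + (n(n−3)/2) x^{n−4} y²)` has total degree
at most `n − 3`. -/
theorem XB_leading_terms (n : ℕ) (hn : 4 ≤ n) :
    (XB n - (X 0 ^ n - C (n : ℤ) * X 0 ^ (n - 2) * X 1 - C (n : ℤ) * X 0 ^ (n - 2)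
        + C ((n : ℤ) * ((n : ℤ) - 3) / 2) * X 0 ^ (n - 4) * X 1 ^ 2)).totalDegree
      ≤ n - 3 := by
  obtain ⟨m, rfl⟩ := Nat.exists_eq_add_of_le' hn
  have h := totalDegree_XB_sub_four_terms_le m
  have hc : ((m + 4 : ℕ) : ℤ) - 3 = (m : ℤ) + 1 := by
    push_cast
    ring
  rw [hc, Nat.cast_add, Nat.cast_ofNat]
  exact h
end

section
/- For all n ≥ 1, both X_n and Y_n have total degree at most n, and if X̄_n, Ȳ_n ∈ ℂ[X,Y,Z] denote their degree-n homogenizations (i.e., X̄_n(X,Y,Z) = Z^n·X_n(X/Z, Y/Z) and similarly for Ȳ_n), then the only common zero in ℂ³ of the three homogeneous polynomials X̄_n, Ȳ_n, Z^n is (0,0,0). Consequently the homogenized folding map Ā_n : ℙ² → ℙ², [X:Y:Z] ↦ [X̄_n : Ȳ_n : Z^n], is a morphism of degree n. -/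
open MvPolynomial

/-- The pair `(X_n, Y_n)` of coordinates in `ℂ[x,y]` (with `X 0 = x`, `X 1 = y`) of
the `n`-th folding map `A_n` of the Lie algebra `𝒜₂`:
`(X_0,Y_0) = (3,0)`, `(X_1,Y_1) = (x,y)`, `(X_2,Y_2) = (x²−y²−2x, 2xy+2y)`, and
`X_n = x(X_{n−1}−X_{n−2}) − y(Y_{n−1}+Y_{n−2}) + X_{n−3}`,
`Y_n = x(Y_{n−1}−Y_{n−2}) + y(X_{n−1}+X_{n−2}) + Y_{n−3}` for `n ≥ 3`;
equivalently `X_n + iY_n = A_n(x+iy, x−iy)`. -/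
noncomputable def Axy : ℕ → MvPolynomial (Fin 2) ℂ × MvPolynomial (Fin 2) ℂ
  | 0 => (3, 0)
  | 1 => (X 0, X 1)
  | 2 => (X 0 ^ 2 - X 1 ^ 2 - 2 * X 0, 2 * X 0 * X 1 + 2 * X 1)
  | n + 3 =>
      (X 0 * ((Axy (n + 2)).1 - (Axy (n + 1)).1)
          - X 1 * ((Axy (n + 2)).2 + (Axy (n + 1)).2) + (Axy n).1,
        X 0 * ((Axy (n + 2)).2 - (Axy (n + 1)).2)
          + X 1 * ((Axy (n + 2)).1 + (Axy (n + 1)).1) + (Axy n).2)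

/-- The degree-`n` homogenization of a polynomial `p(x,y)` of total degree at most `n`:
`p̄(X,Y,Z) = Z^n · p(X/Z, Y/Z)`, obtained by padding each monomial `x^i y^j` of `p`
with `Z^{n−i−j}`. -/
noncomputable def homog (n : ℕ) (p : MvPolynomial (Fin 2) ℂ) : MvPolynomial (Fin 3) ℂ :=
  ∑ m ∈ p.support,
    C (coeff m p) * X 0 ^ (m 0) * X 1 ^ (m 1) * X 2 ^ (n - (m 0 + m 1))

theorem X_mul_mem_restrictTotalDegree {p : MvPolynomial (Fin 2) ℂ} {n : ℕ} (i : Fin 2)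
    (hp : p ∈ restrictTotalDegree (Fin 2) ℂ n) :
    X i * p ∈ restrictTotalDegree (Fin 2) ℂ (n + 1) := by
  rw [mem_restrictTotalDegree] at *
  have h := totalDegree_mul (X i) p
  rw [totalDegree_X] at h
  omega

theorem restrictTotalDegree_le {m n : ℕ} (h : m ≤ n) :
    restrictTotalDegree (Fin 2) ℂ m ≤ restrictTotalDegree (Fin 2) ℂ n := by
  intro p hp
  rw [mem_restrictTotalDegree] at *
  omega

theorem X_mem_restrictTotalDegree (i : Fin 2) :
    (X i : MvPolynomial (Fin 2) ℂ) ∈ restrictTotalDegree (Fin 2) ℂ 1 := by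
  simp [mem_restrictTotalDegree]

/-- The coordinates of `A_n` have total degree at most `n`. -/
theorem Axy_mem_restrictTotalDegree (n : ℕ) :
    (Axy n).1 ∈ restrictTotalDegree (Fin 2) ℂ n ∧
      (Axy n).2 ∈ restrictTotalDegree (Fin 2) ℂ n := by
  induction n using Nat.strong_induction_on with
  | _ n ih =>
    match n with
    | 0 =>
      simp only [Axy, zero_mem, and_true, mem_restrictTotalDegree]
      exact (totalDegree_C (3 : ℂ)).le
    | 1 => exact ⟨X_mem_restrictTotalDegree 0, X_mem_restrictTotalDegree 1⟩
    | 2 =>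
      have hX : ∀ i : Fin 2, (X i : MvPolynomial (Fin 2) ℂ) ∈ restrictTotalDegree (Fin 2) ℂ 2 :=
        fun i => restrictTotalDegree_le one_le_two (X_mem_restrictTotalDegree i)
      have hXX : ∀ i j : Fin 2,
          (X i * X j : MvPolynomial (Fin 2) ℂ) ∈ restrictTotalDegree (Fin 2) ℂ 2 :=
        fun i j => X_mul_mem_restrictTotalDegree i (X_mem_restrictTotalDegree j)
      simp only [Axy, sq, two_mul, add_mul]
      exact ⟨sub_mem (sub_mem (hXX 0 0) (hXX 1 1)) (add_mem (hX 0) (hX 0)),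
        add_mem (add_mem (hXX 0 1) (hXX 0 1)) (add_mem (hX 1) (hX 1))⟩
    | n + 3 =>
      obtain ⟨hX₀, hY₀⟩ := ih n (by omega)
      obtain ⟨hX₁, hY₁⟩ := ih (n + 1) (by omega)
      obtain ⟨hX₂, hY₂⟩ := ih (n + 2) (by omega)
      replace hX₀ := restrictTotalDegree_le (show n ≤ n + 3 by omega) hX₀
      replace hY₀ := restrictTotalDegree_le (show n ≤ n + 3 by omega) hY₀
      replace hX₁ := restrictTotalDegree_le (show n + 1 ≤ n + 2 by omega) hX₁
      replace hY₁ := restrictTotalDegree_le (show n + 1 ≤ n + 2 by omega) hY₁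
      rw [Axy]
      exact ⟨add_mem (sub_mem (X_mul_mem_restrictTotalDegree 0 (sub_mem hX₂ hX₁))
          (X_mul_mem_restrictTotalDegree 1 (add_mem hY₂ hY₁))) hX₀,
        add_mem (add_mem (X_mul_mem_restrictTotalDegree 0 (sub_mem hY₂ hY₁))
          (X_mul_mem_restrictTotalDegree 1 (add_mem hX₂ hX₁))) hY₀⟩

theorem C_mul_mem_restrictTotalDegree {p : MvPolynomial (Fin 2) ℂ} {n : ℕ} (c : ℂ)
    (hp : p ∈ restrictTotalDegree (Fin 2) ℂ n) :
    C c * p ∈ restrictTotalDegree (Fin 2) ℂ n := by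
  rw [← smul_eq_C_mul]
  exact Submodule.smul_mem _ c hp

/-- If `ε² = -1`, the leading form of `X_n + εY_n` is `(x + εy)^n`. -/
theorem Axy_sub_pow_mem_restrictTotalDegree {ε : ℂ} (hε : ε ^ 2 = -1) (n : ℕ) :
    (Axy (n + 1)).1 + C ε * (Axy (n + 1)).2 - (X 0 + C ε * X 1) ^ (n + 1) ∈
      restrictTotalDegree (Fin 2) ℂ n := by
  have hC : (C ε : MvPolynomial (Fin 2) ℂ) ^ 2 = -1 := by rw [← C_pow, hε]; simp
  induction n with
  | zero => simp [Axy]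
  | succ n ih =>
    match n with
    | 0 =>
      have hX := X_mem_restrictTotalDegree 0
      have hY := C_mul_mem_restrictTotalDegree ε (X_mem_restrictTotalDegree 1)
      convert add_mem (neg_mem (add_mem hX hX)) (add_mem hY hY) using 1
      simp only [Axy]
      linear_combination (-X 1 ^ 2) * hC
    | n + 1 =>
      obtain ⟨hX₀, hY₀⟩ := Axy_mem_restrictTotalDegree n
      obtain ⟨hX₁, hY₁⟩ := Axy_mem_restrictTotalDegree (n + 1)
      have h₀ := restrictTotalDegree_le (show n ≤ n + 2 by omega)
        (add_mem hX₀ (C_mul_mem_restrictTotalDegree ε hY₀))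
      have h₁ := add_mem hX₁ (C_mul_mem_restrictTotalDegree ε hY₁)
      have hlin : ∀ {c : ℂ} {p : MvPolynomial (Fin 2) ℂ},
          p ∈ restrictTotalDegree (Fin 2) ℂ (n + 1) →
          X 0 * p + C c * (X 1 * p) ∈ restrictTotalDegree (Fin 2) ℂ (n + 2) := fun hp =>
        add_mem (X_mul_mem_restrictTotalDegree 0 hp)
          (C_mul_mem_restrictTotalDegree _ (X_mul_mem_restrictTotalDegree 1 hp))
      convert add_mem (sub_mem (hlin (c := ε) ih) (hlin (c := -ε) h₁)) h₀ using 1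
      rw [show n + 1 + 1 + 1 = n + 3 from rfl, Axy, C_neg]
      linear_combination (-(X 1 * (Axy (n + 2)).2) - X 1 * (Axy (n + 1)).2) * hC

theorem homogeneousComponent_Axy {ε : ℂ} (hε : ε ^ 2 = -1) {n : ℕ} (hn : 1 ≤ n) :
    homogeneousComponent n (Axy n).1 + C ε * homogeneousComponent n (Axy n).2 =
      (X 0 + C ε * X 1) ^ n := by
  obtain ⟨n, rfl⟩ := Nat.exists_eq_add_of_le' hn
  have h := Axy_sub_pow_mem_restrictTotalDegree hε n
  rw [mem_restrictTotalDegree] at h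
  have hlow := homogeneousComponent_eq_zero _ _ (Nat.lt_succ_of_le h)
  have hhom : ((X 0 + C ε * X 1 : MvPolynomial (Fin 2) ℂ) ^ (n + 1)).IsHomogeneous (n + 1) := by
    simpa using ((isHomogeneous_X ℂ (0 : Fin 2)).add
      (isHomogeneous_C_mul_X ε (1 : Fin 2))).pow (n + 1)
  have htop := homogeneousComponent_of_mem (m := n + 1) hhom
  rw [if_pos rfl] at htop
  rw [Nat.succ_eq_add_one, map_sub, map_add, homogeneousComponent_C_mul, htop] at hlow
  exact sub_eq_zero.mp hlow

/-- On the line at infinity `Z = 0`, the degree-`n` homogenization is the degree-`n` component. -/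
theorem eval_homog_of_eq_zero {n : ℕ} {p : MvPolynomial (Fin 2) ℂ} (hp : p.totalDegree ≤ n)
    {v : Fin 3 → ℂ} (hv : v 2 = 0) :
    eval v (homog n p) = eval ![v 0, v 1] (homogeneousComponent n p) := by
  rw [homog, homogeneousComponent_apply, map_sum, map_sum, Finset.sum_filter]
  refine Finset.sum_congr rfl fun m hm => ?_
  have hdeg : m.degree = m 0 + m 1 := by simp [Finsupp.degree_eq_sum]
  have hle : m.degree ≤ n := (le_totalDegree hm).trans hp
  split_ifs with h
  · simp [eval_monomial, Finsupp.prod_fintype, ← hdeg, h, mul_assoc]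
  · have : n - (m 0 + m 1) ≠ 0 := by omega
    simp [hv, this]

/-- For `n ≥ 1`, the coordinates `X_n, Y_n` of the folding map `A_n` of `𝒜₂` have
total degree at most `n`, and the only common zero in `ℂ³` of the degree-`n`
homogenizations `X̄_n, Ȳ_n` together with `Z^n` is `(0,0,0)`.  Consequently the
homogenized folding map `Ā_n = [X̄_n : Ȳ_n : Z^n] : ℙ² → ℙ²` is a morphism of
degree `n`. -/
theorem Abar_is_morphism (n : ℕ) (hn : 1 ≤ n) :
    (Axy n).1.totalDegree ≤ n ∧ (Axy n).2.totalDegree ≤ n ∧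
    ∀ v : Fin 3 → ℂ,
      eval v (homog n (Axy n).1) = 0 →
      eval v (homog n (Axy n).2) = 0 →
      v 2 ^ n = 0 →
      v = 0 := by
  obtain ⟨hX, hY⟩ := Axy_mem_restrictTotalDegree n
  rw [mem_restrictTotalDegree] at hX hY
  refine ⟨hX, hY, fun v h₁ h₂ h₃ => ?_⟩
  have hv : v 2 = 0 := eq_zero_of_pow_eq_zero h₃
  rw [eval_homog_of_eq_zero hX hv] at h₁
  rw [eval_homog_of_eq_zero hY hv] at h₂
  have key : ∀ ε : ℂ, ε ^ 2 = -1 → v 0 + ε * v 1 = 0 := fun ε hε => by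
    have h := congrArg (eval ![v 0, v 1]) (homogeneousComponent_Axy hε hn)
    simp only [map_add, map_mul, map_pow, eval_C, eval_X, h₁, h₂, mul_zero, add_zero] at h
    exact eq_zero_of_pow_eq_zero h.symm
  have hp := key Complex.I Complex.I_sq
  have hm := key (-Complex.I) (by simp)
  have h0 : v 0 = 0 := by linear_combination (hp + hm) / 2
  have h1 : v 1 = 0 := by
    simpa [h0] using hp
  ext i
  fin_cases i
  exacts [h0, h1, hv]
end
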